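/- Let H be a nonzero complex Hilbert space and let B, C be bounded linear operators on H. Then (1/2)·‖B + C‖² ≤ w_e(|B|, |C|)·w_e(|B*|, |C*|). -/

import Mathlib

open scoped InnerProductSpace
open ContinuousLinearMap

variable {H : Type*} [NormedAddCommGroup H] [InnerProductSpace ℂ H]
  [CompleteSpace H] [Nontrivial H]

/-- The numerical radius of a bounded linear operator. -/
noncomputable def numRad (A : H →L[ℂ] H) : ℝ :=
  ⨆ x : {x : H // ‖x‖ = 1}, ‖⟪A x.1, x.1⟫_ℂ‖

/-- The Crawford number of a bounded linear operator. -/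
noncomputable def crawford (A : H →L[ℂ] H) : ℝ :=
  ⨅ x : {x : H // ‖x‖ = 1}, ‖⟪A x.1, x.1⟫_ℂ‖

/-- The Euclidean operator radius of a pair of bounded linear operators. -/
noncomputable def euclRad (B C : H →L[ℂ] H) : ℝ :=
  ⨆ x : {x : H // ‖x‖ = 1}, Real.sqrt (‖⟪B x.1, x.1⟫_ℂ‖ ^ 2 + ‖⟪C x.1, x.1⟫_ℂ‖ ^ 2)

/-- The absolute value `|A| = (A*A)^(1/2)` of a bounded linear operator. -/
noncomputable def opAbs (A : H →L[ℂ] H) : H →L[ℂ] H := CFC.sqrt (adjoint A * A)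

/-- The real part `Re(A) = (A + A*)/2` of a bounded linear operator. -/
noncomputable def reOp (A : H →L[ℂ] H) : H →L[ℂ] H := (2 : ℂ)⁻¹ • (A + adjoint A)

/-- The imaginary part `Im(A) = (A - A*)/(2i)` of a bounded linear operator. -/
noncomputable def imOp (A : H →L[ℂ] H) : H →L[ℂ] H := (2 * Complex.I)⁻¹ • (A - adjoint A)

/-- In a C⋆-algebra, an element intertwining the squares of two nonnegative elements intertwines
the elements themselves. -/
theorem SemiconjBy.of_mul_self_nonneg {A : Type*} [CStarAlgebra A] [PartialOrder A]
    [StarOrderedRing A] {b p q : A} (hp : 0 ≤ p) (hq : 0 ≤ q)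
    (h : SemiconjBy b (p * p) (q * q)) : SemiconjBy b p q := by
  have hps : star p = p := hp.isSelfAdjoint
  have hqs : star q = q := hq.isSelfAdjoint
  set x := b * p - q * b with hx
  have hqx : q * x = -(x * p) := by
    have h' : b * (p * p) = q * q * b := h
    rw [eq_neg_iff_add_eq_zero, hx]
    calc q * (b * p - q * b) + (b * p - q * b) * p
        = b * (p * p) - q * q * b := by noncomm_ring
      _ = 0 := by rw [h', sub_self]
  have hconj : star x * q * x = -(star x * x * p) := by
    rw [mul_assoc, hqx, mul_neg, mul_assoc]
  have hle : star x * x * p ≤ 0 := by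
    rw [← neg_nonneg, ← hconj]
    exact star_left_conjugate_nonneg hq x
  have hcomm : Commute (star x * x) p := by
    have hs := congrArg star hconj
    simp only [star_mul, star_neg, star_star, hps, hqs] at hs
    rw [← mul_assoc, hconj, neg_inj] at hs
    exact hs
  have hzero : star x * x * p = 0 :=
    le_antisymm hle (Commute.mul_nonneg (star_mul_self_nonneg x) hp hcomm)
  have hxp : x * p = 0 := by
    rw [← CStarRing.star_mul_self_eq_zero_iff, star_mul, mul_assoc, ← mul_assoc (star x), hzero,
      mul_zero]
  have hpx : p * star x = 0 := by
    simpa [hps] using congrArg star hxp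
  have hxq : star x * q = 0 := by
    simpa [hqs, hxp] using congrArg star hqx
  have hxx : star x * x = star x * b * p := by
    conv_lhs => rw [hx, mul_sub, ← mul_assoc, ← mul_assoc, hxq, zero_mul, sub_zero]
  have hx0 : star x * x = 0 := by
    rw [← CStarRing.star_mul_self_eq_zero_iff, (IsSelfAdjoint.star_mul_self x).star_eq]
    nth_rewrite 1 [hxx]
    rw [mul_assoc, ← mul_assoc p, hpx, zero_mul, mul_zero]
  exact sub_eq_zero.mp ((CStarRing.star_mul_self_eq_zero_iff x).mp hx0)

section

variable {E : Type*} [NormedAddCommGroup E] [InnerProductSpace ℂ E]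

theorem sqrt_le_euclRad (B C : E →L[ℂ] E) {x : E} (hx : ‖x‖ = 1) :
    √(‖⟪B x, x⟫_ℂ‖ ^ 2 + ‖⟪C x, x⟫_ℂ‖ ^ 2) ≤ euclRad B C := by
  refine le_ciSup (f := fun x : {x : E // ‖x‖ = 1} ↦
    √(‖⟪B x.1, x.1⟫_ℂ‖ ^ 2 + ‖⟪C x.1, x.1⟫_ℂ‖ ^ 2)) ⟨√(‖B‖ ^ 2 + ‖C‖ ^ 2), ?_⟩ ⟨x, hx⟩
  have hbound (T : E →L[ℂ] E) {z : E} (hz : ‖z‖ = 1) : ‖⟪T z, z⟫_ℂ‖ ≤ ‖T‖ := by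
    simpa [hz] using (norm_inner_le_norm (𝕜 := ℂ) (T z) z).trans
      (mul_le_mul_of_nonneg_right (T.le_opNorm z) (norm_nonneg z))
  rintro _ ⟨⟨z, hz⟩, rfl⟩
  dsimp only
  gcongr
  · exact hbound B hz
  · exact hbound C hz

variable [CompleteSpace E]

theorem opAbs_nonneg (A : E →L[ℂ] E) : 0 ≤ opAbs A := CFC.sqrt_nonneg _

theorem opAbs_mul_self (A : E →L[ℂ] E) : opAbs A * opAbs A = adjoint A * A :=
  CFC.sqrt_mul_sqrt_self _ (star_mul_self_nonneg A)

theorem semiconjBy_opAbs (A : E →L[ℂ] E) : SemiconjBy A (opAbs A) (opAbs (adjoint A)) := by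
  refine .of_mul_self_nonneg (opAbs_nonneg _) (opAbs_nonneg _) ?_
  rw [opAbs_mul_self, opAbs_mul_self, adjoint_adjoint, SemiconjBy, mul_assoc]

/-- The Cauchy–Schwarz inequality for the semi-inner product given by a positive operator. -/
theorem norm_inner_sq_le_of_nonneg {Q : E →L[ℂ] E} (hQ : 0 ≤ Q) (x y : E) :
    ‖⟪Q x, y⟫_ℂ‖ ^ 2 ≤ ‖⟪Q x, x⟫_ℂ‖ * ‖⟪Q y, y⟫_ℂ‖ := by
  have hR (u v : E) : ⟪Q u, v⟫_ℂ = ⟪CFC.sqrt Q u, CFC.sqrt Q v⟫_ℂ := by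
    have hpos := (nonneg_iff_isPositive _).mp (CFC.sqrt_nonneg Q)
    conv_lhs => rw [← CFC.sqrt_mul_sqrt_self Q hQ]
    exact hpos.inner_left_eq_inner_right _ _
  rw [hR, hR, hR, ← inner_self_re_eq_norm, ← inner_self_re_eq_norm, inner_self_eq_norm_mul_norm,
    inner_self_eq_norm_mul_norm]
  calc ‖⟪CFC.sqrt Q x, CFC.sqrt Q y⟫_ℂ‖ ^ 2
      ≤ (‖CFC.sqrt Q x‖ * ‖CFC.sqrt Q y‖) ^ 2 := by
        gcongr
        exact norm_inner_le_norm _ _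
    _ = _ := by ring

/-- The mixed Schwarz inequality. -/
theorem norm_inner_sq_le_opAbs (A : E →L[ℂ] E) (x y : E) :
    ‖⟪A x, y⟫_ℂ‖ ^ 2 ≤ ‖⟪opAbs A x, x⟫_ℂ‖ * ‖⟪opAbs (adjoint A) y, y⟫_ℂ‖ := by
  set P := opAbs A
  set Q := opAbs (adjoint A)
  have hpos : P.IsPositive := (nonneg_iff_isPositive _).mp (opAbs_nonneg A)
  have hAP (u : E) : A (P u) = Q (A u) := DFunLike.congr_fun (semiconjBy_opAbs A).eq u
  have hPP (u : E) : P (P u) = adjoint A (A u) := DFunLike.congr_fun (opAbs_mul_self A) u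
  have hrange (u : E) : ‖⟪A (P u), y⟫_ℂ‖ ^ 2 ≤ ‖⟪P (P u), P u⟫_ℂ‖ * ‖⟪Q y, y⟫_ℂ‖ := by
    have hcs := norm_inner_sq_le_of_nonneg (opAbs_nonneg (adjoint A)) (A u) y
    have hinner : ⟪Q (A u), A u⟫_ℂ = ⟪P (P u), P u⟫_ℂ := by
      rw [← hAP, ← adjoint_inner_left, ← adjoint_inner_right, adjoint_adjoint, ← adjoint_inner_left,
        ← hPP, hpos.inner_left_eq_inner_right]
    rwa [hinner, ← hAP] at hcs
  have hclosure : ∀ u ∈ P.range.topologicalClosure,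
      ‖⟪A u, y⟫_ℂ‖ ^ 2 ≤ ‖⟪P u, u⟫_ℂ‖ * ‖⟪Q y, y⟫_ℂ‖ := by
    have hclosed : IsClosed {u : E | ‖⟪A u, y⟫_ℂ‖ ^ 2 ≤ ‖⟪P u, u⟫_ℂ‖ * ‖⟪Q y, y⟫_ℂ‖} :=
      isClosed_le (by fun_prop) (by fun_prop)
    intro u hu
    refine closure_minimal ?_ hclosed hu
    rintro _ ⟨v, rfl⟩
    exact hrange v
  obtain ⟨u, hu, v, hv, rfl⟩ :=
    Submodule.exists_add_mem_mem_orthogonal (K := P.range.topologicalClosure) x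
  have hPv : P v = 0 := by
    rw [Submodule.orthogonal_closure, orthogonal_range, hpos.isSelfAdjoint.adjoint_eq] at hv
    exact hv
  have hAv : A v = 0 := by
    rw [← norm_eq_zero, ← sq_eq_zero_iff, apply_norm_sq_eq_inner_adjoint_left, comp_apply, ← hPP,
      hPv, map_zero, inner_zero_left, map_zero]
  have hPuv : ⟪P u, v⟫_ℂ = 0 := by
    rw [hpos.inner_left_eq_inner_right, hPv, inner_zero_right]
  simpa [map_add, hPv, hAv, inner_add_right, hPuv] using hclosure u hu

theorem norm_inner_add_sq_le_euclRad (B C : E →L[ℂ] E) {x y : E} (hx : ‖x‖ = 1) (hy : ‖y‖ = 1) :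
    ‖⟪(B + C) x, y⟫_ℂ‖ ^ 2 ≤
      2 * (euclRad (opAbs B) (opAbs C) * euclRad (opAbs (adjoint B)) (opAbs (adjoint C))) := by
  have hB := norm_inner_sq_le_opAbs B x y
  have hC := norm_inner_sq_le_opAbs C x y
  have hw := sqrt_le_euclRad (opAbs B) (opAbs C) hx
  have hw' := sqrt_le_euclRad (opAbs (adjoint B)) (opAbs (adjoint C)) hy
  set b := ‖⟪opAbs B x, x⟫_ℂ‖
  set c := ‖⟪opAbs C x, x⟫_ℂ‖
  set b' := ‖⟪opAbs (adjoint B) y, y⟫_ℂ‖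
  set c' := ‖⟪opAbs (adjoint C) y, y⟫_ℂ‖
  have hcs : b * b' + c * c' ≤ √(b ^ 2 + c ^ 2) * √(b' ^ 2 + c' ^ 2) := by
    rw [← Real.sqrt_mul (by positivity)]
    exact Real.le_sqrt_of_sq_le (by nlinarith [sq_nonneg (b * c' - c * b')])
  calc ‖⟪(B + C) x, y⟫_ℂ‖ ^ 2
      ≤ (‖⟪B x, y⟫_ℂ‖ + ‖⟪C x, y⟫_ℂ‖) ^ 2 := by
        rw [add_apply, inner_add_left]
        gcongr
        exact norm_add_le _ _
    _ ≤ 2 * (‖⟪B x, y⟫_ℂ‖ ^ 2 + ‖⟪C x, y⟫_ℂ‖ ^ 2) := add_sq_le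
    _ ≤ 2 * (b * b' + c * c') := by gcongr
    _ ≤ 2 * (√(b ^ 2 + c ^ 2) * √(b' ^ 2 + c' ^ 2)) := by gcongr
    _ ≤ _ := by
        have := (Real.sqrt_nonneg _).trans hw
        gcongr

end

theorem stmt18 (B C : H →L[ℂ] H) :
    (1/2) * ‖B + C‖ ^ 2 ≤
      euclRad (opAbs B) (opAbs C) * euclRad (opAbs (adjoint B)) (opAbs (adjoint C)) := by
  set W := euclRad (opAbs B) (opAbs C) * euclRad (opAbs (adjoint B)) (opAbs (adjoint C))
  have hW0 : 0 ≤ W :=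
    mul_nonneg (Real.iSup_nonneg fun _ ↦ Real.sqrt_nonneg _)
      (Real.iSup_nonneg fun _ ↦ Real.sqrt_nonneg _)
  have hnorm : ‖B + C‖ ≤ √(2 * W) := by
    refine opNorm_le_of_unit_norm (𝕜 := ℂ) (Real.sqrt_nonneg _) fun x hx ↦ ?_
    by_cases hz : (B + C) x = 0
    · rw [hz, norm_zero]
      exact Real.sqrt_nonneg _
    have hz' : ‖(B + C) x‖ ≠ 0 := norm_ne_zero_iff.mpr hz
    refine Real.le_sqrt_of_sq_le ?_
    have h := norm_inner_add_sq_le_euclRad B C hx (norm_smul_inv_norm (𝕜 := ℂ) hz)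
    rw [inner_smul_right, norm_mul, ← inner_self_re_eq_norm, inner_self_eq_norm_mul_norm, norm_inv,
      RCLike.norm_ofReal, abs_norm, inv_mul_cancel_left₀ hz'] at h
    exact h
  have hsq := pow_le_pow_left₀ (norm_nonneg _) hnorm 2
  rw [Real.sq_sqrt (by positivity)] at hsq
  linarith
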